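/- arXiv:0911.2562 — 2 statements merged into one kernel-verified Lean document; each statement's English description precedes it below -/
import Mathlib

section
/- Let D_1,…,D_q be hypersurfaces in ℂP^M in N-subgeneral position in a smooth projective variety V ⊂ ℂP^M of dimension n, where N ≥ n and q ≥ 2N−n+1. Then there exist real constants ω(1),…,ω(q) and Θ satisfying: (i) 0 < ω(j) ≤ Θ ≤ 1 for 1 ≤ j ≤ q; (ii) Σ_{j=1}^q ω(j) = Θ(q−2N+n−1) + n + 1; (iii) (n+1)/(2N−n+1) ≤ Θ ≤ (n+1)/(N+1); (iv) for every R ⊆ Q with 0 < #R ≤ N+1, Σ_{j∈R} ω(j) ≤ c(R). -/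
open MvPolynomial Filter

noncomputable section

namespace SMT

/-- The affine cone in `ℂ^K` cut out by an ideal of polynomials
(the common zero set of all its members). -/
def coneOf {K : ℕ} (I : Ideal (MvPolynomial (Fin K) ℂ)) : Set (Fin K → ℂ) :=
  {x | ∀ Q ∈ I, MvPolynomial.eval x Q = 0}

/-- The vanishing ideal of a subset of `ℂ^K`. -/
def vIdeal {K : ℕ} (A : Set (Fin K → ℂ)) : Ideal (MvPolynomial (Fin K) ℂ) where
  carrier := {Q | ∀ x ∈ A, MvPolynomial.eval x Q = 0}
  add_mem' := by
    intro a b ha hb x hx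
    simp [ha x hx, hb x hx]
  zero_mem' := by
    intro x hx
    simp
  smul_mem' := by
    intro c p hp x hx
    simp [smul_eq_mul, hp x hx]

/-- The dimension of (the affine cone over) a subset of `ℂ^K`:
the Krull dimension of its coordinate ring, read off as a natural number. -/
def coneDim {K : ℕ} (A : Set (Fin K → ℂ)) : ℕ :=
  ENat.toNat ((ringKrullDim (MvPolynomial (Fin K) ℂ ⧸ vIdeal A)).unbotD 0)

/-- `I` is the homogeneous (prime) ideal of a complex projective variety of dimension `n`
in `ℂP^{K-1}`: it is prime, generated by homogeneous polynomials, and the affine cone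
has Krull dimension `n + 1`. -/
def IsVariety {K : ℕ} (n : ℕ) (I : Ideal (MvPolynomial (Fin K) ℂ)) : Prop :=
  I.IsPrime ∧
  (∃ S : Set (MvPolynomial (Fin K) ℂ), (∀ Q ∈ S, ∃ e, Q.IsHomogeneous e) ∧ I = Ideal.span S) ∧
  ringKrullDim (MvPolynomial (Fin K) ℂ ⧸ I) = (((n + 1 : ℕ) : ℕ∞) : WithBot ℕ∞)

/-- A smooth complex projective variety of dimension `n` in `ℂP^{K-1}`, presented by its
homogeneous prime ideal: smoothness via the Jacobian criterion at every nonzero point of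
the affine cone. -/
def IsSmoothVariety {K : ℕ} (n : ℕ) (I : Ideal (MvPolynomial (Fin K) ℂ)) : Prop :=
  IsVariety n I ∧
  ∀ x ∈ coneOf I, x ≠ 0 →
    Module.finrank ℂ (Submodule.span ℂ
      {v : Fin K → ℂ | ∃ Q ∈ I, v = fun i => MvPolynomial.eval x (MvPolynomial.pderiv i Q)})
      = K - 1 - n

/-- The affine cone over the hypersurface defined by a homogeneous polynomial. -/
def hypCone {K : ℕ} (Q : MvPolynomial (Fin K) ℂ) : Set (Fin K → ℂ) :=
  {x | MvPolynomial.eval x Q = 0}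

/-- The affine cone over `V ∩ (∩_{j ∈ R} D_j)`. -/
def interCone {K q : ℕ} (I : Ideal (MvPolynomial (Fin K) ℂ))
    (Q : Fin q → MvPolynomial (Fin K) ℂ) (R : Finset (Fin q)) : Set (Fin K → ℂ) :=
  coneOf I ∩ ⋂ j ∈ R, hypCone (Q j)

/-- The codimension function `c(R) = codim_V (V ∩ ∩_{j∈R} D_j)`, with `c(∅) = 0` and
the convention `codim ∅ = n+1` (the cone over the empty projective set is `{0}`,
of cone dimension `0`). -/
def cdim {K q : ℕ} (n : ℕ) (I : Ideal (MvPolynomial (Fin K) ℂ))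
    (Q : Fin q → MvPolynomial (Fin K) ℂ) (R : Finset (Fin q)) : ℕ :=
  n + 1 - coneDim (interCone I Q R)

/-- `ρ(R₁,R₂) = (c(R₂) - c(R₁)) / (#R₂ - #R₁)`. -/
def rho {K q : ℕ} (n : ℕ) (I : Ideal (MvPolynomial (Fin K) ℂ))
    (Q : Fin q → MvPolynomial (Fin K) ℂ) (R₁ R₂ : Finset (Fin q)) : ℝ :=
  ((cdim n I Q R₂ : ℝ) - (cdim n I Q R₁ : ℝ)) / ((R₂.card : ℝ) - (R₁.card : ℝ))

/-- The hypersurfaces `D_j = {Q j = 0}`, `j ∈ S`, are in general position in the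
projective variety `V` (of dimension `n`) defined by `I`: any `s` of them (`1 ≤ s ≤ n+1`)
can be complemented by `n+1-s` further hypersurfaces so that the total intersection with
`V` is empty (in projective space, i.e. the cones meet only in `0`). -/
def GenPos {K q : ℕ} (n : ℕ) (I : Ideal (MvPolynomial (Fin K) ℂ))
    (Q : Fin q → MvPolynomial (Fin K) ℂ) (S : Finset (Fin q)) : Prop :=
  ∀ J : Finset (Fin q), J ⊆ S → 1 ≤ J.card → J.card ≤ n + 1 →
    ∃ Q' : Fin (n + 1 - J.card) → MvPolynomial (Fin K) ℂ,
      (∀ k, ∃ e, 1 ≤ e ∧ (Q' k).IsHomogeneous e) ∧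
      ∀ x ∈ interCone I Q J, (∀ k, MvPolynomial.eval x (Q' k) = 0) → x = 0

/-- A set is algebraic if it is the zero set of its vanishing ideal. -/
def IsAlgSet {K : ℕ} (A : Set (Fin K → ℂ)) : Prop := A = coneOf (vIdeal A)

/-- `σ` is an irreducible component of `S`: an algebraic irreducible subset of `S`,
maximal among such. -/
def IsIrredComponent {K : ℕ} (σ S : Set (Fin K → ℂ)) : Prop :=
  σ ⊆ S ∧ IsAlgSet σ ∧ (vIdeal σ).IsPrime ∧
  ∀ τ : Set (Fin K → ℂ), τ ⊆ S → IsAlgSet τ → (vIdeal τ).IsPrime → σ ⊆ τ → σ = τ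

/-- Condition (i) of Definition 1.1: any `N+1` of the hypersurfaces meet `V` in the
empty (projective) set. -/
def SubgenI {K q : ℕ} (N : ℕ) (I : Ideal (MvPolynomial (Fin K) ℂ))
    (Q : Fin q → MvPolynomial (Fin K) ℂ) : Prop :=
  ∀ J : Finset (Fin q), J.card = N + 1 → ∀ x ∈ interCone I Q J, x = 0

/-- Condition (ii) of Definition 1.1. -/
def SubgenII {K q : ℕ} (n : ℕ) (I : Ideal (MvPolynomial (Fin K) ℂ))
    (Q : Fin q → MvPolynomial (Fin K) ℂ) : Prop :=
  ∀ J : Finset (Fin q), 0 < J.card → J.card ≤ n + 1 → GenPos n I Q J →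
    (∃ x ∈ interCone I Q J, x ≠ 0) →
    ∃ σ : Set (Fin K → ℂ), IsIrredComponent σ (interCone I Q J) ∧
      coneDim σ = coneDim (interCone I Q J) ∧
      ∀ i ∉ J, coneDim (interCone I Q (insert i J)) = coneDim (interCone I Q J) →
        σ ⊆ hypCone (Q i)

/-- The hypersurfaces `D_j = {Q j = 0}` are in `N`-subgeneral position in the projective
variety `V` defined by `I` (Definition 1.1), including the requirement `V ⊄ D_j`. -/
def InSubgenPos {K q : ℕ} (n N : ℕ) (I : Ideal (MvPolynomial (Fin K) ℂ))
    (Q : Fin q → MvPolynomial (Fin K) ℂ) : Prop :=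
  (∀ j, ¬ (coneOf I ⊆ hypCone (Q j))) ∧ SubgenI N I Q ∧ SubgenII n I Q

/-- The Hilbert function `H_X(m) = dim_ℂ ℂ[x]_m / I(m)` of (the variety with homogeneous
ideal) `I`. -/
def hilbert {K : ℕ} (I : Ideal (MvPolynomial (Fin K) ℂ)) (m : ℕ) : ℕ :=
  Module.finrank ℂ
    ((MvPolynomial.homogeneousSubmodule (Fin K) ℂ m) ⧸
      (Submodule.comap (MvPolynomial.homogeneousSubmodule (Fin K) ℂ m).subtype
        (Submodule.restrictScalars ℂ I)))

/-- The degree of an `n`-dimensional projective variety with homogeneous ideal `I`: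
the (unique) natural number `Δ` with `H(m) = Δ·mⁿ/n! + O(m^{n-1})`. -/
def pdeg {K : ℕ} (n : ℕ) (I : Ideal (MvPolynomial (Fin K) ℂ)) : ℕ :=
  sInf {Δ : ℕ | Filter.Tendsto
    (fun m : ℕ => (hilbert I m : ℝ) * (n.factorial : ℝ) / (m : ℝ) ^ n)
    Filter.atTop (nhds (Δ : ℝ))}

/-- The image cone of the cone of `I` under `x ↦ (Q_1(x), …, Q_q(x))`. -/
def imgCone {K q : ℕ} (I : Ideal (MvPolynomial (Fin K) ℂ))
    (Q : Fin q → MvPolynomial (Fin K) ℂ) : Set (Fin q → ℂ) :=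
  (fun x j => MvPolynomial.eval x (Q j)) '' coneOf I

/-! Nevanlinna-theoretic notions. -/

/-- `‖f(z)‖ = max_i |f_i(z)|` for a tuple of functions. -/
def projNorm {ι : Type*} [Fintype ι] (f : ι → ℂ → ℂ) (z : ℂ) : ℝ :=
  ⨆ i, ‖f i z‖

/-- The Nevanlinna characteristic function
`T_f(r) = (2π)⁻¹ ∫_0^{2π} log ‖f(re^{iθ})‖ dθ`. -/
def charFn {ι : Type*} [Fintype ι] (f : ι → ℂ → ℂ) (r : ℝ) : ℝ :=
  (2 * Real.pi)⁻¹ *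
    ∫ θ in (0:ℝ)..(2 * Real.pi),
      Real.log (projNorm f ((r : ℂ) * Complex.exp ((θ : ℂ) * Complex.I)))

/-- The vanishing order of an entire function at a point (the zero divisor). -/
def zeroOrder (φ : ℂ → ℂ) (z : ℂ) : ℕ :=
  sInf {k : ℕ | iteratedDeriv k φ z ≠ 0}

/-- The (unintegrated) counting function `N_φ(r)` of the zero divisor of `φ`. -/
def count (φ : ℂ → ℂ) (r : ℝ) : ℝ :=
  ∫ t in (1:ℝ)..r, (∑ᶠ z ∈ {z : ℂ | ‖z‖ < t}, ((zeroOrder φ z : ℕ) : ℝ)) / t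

/-- The counting function truncated at level `L`. -/
def countTrunc (L : ℕ) (φ : ℂ → ℂ) (r : ℝ) : ℝ :=
  ∫ t in (1:ℝ)..r,
    (∑ᶠ z ∈ {z : ℂ | ‖z‖ < t}, ((min (zeroOrder φ z) L : ℕ) : ℝ)) / t

/-- A tuple of entire functions without common zeros (a reduced representation of a
holomorphic curve in projective space). -/
def ReducedRepr {ι : Type*} [Fintype ι] (f : ι → ℂ → ℂ) : Prop :=
  (∀ i, Differentiable ℂ (f i)) ∧ ∀ z, ∃ i, f i z ≠ 0

/-- The entire function `Q(f_0, …, f_{K-1})`. -/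
def polyComp {K : ℕ} (Q : MvPolynomial (Fin K) ℂ) (f : Fin K → ℂ → ℂ) : ℂ → ℂ :=
  fun z => MvPolynomial.eval (fun i => f i z) Q

/-- The curve with reduced representation `f` has image inside the variety of `I`. -/
def MapsIntoCone {K : ℕ} (f : Fin K → ℂ → ℂ) (I : Ideal (MvPolynomial (Fin K) ℂ)) : Prop :=
  ∀ z, (fun i => f i z) ∈ coneOf I

/-- `f` is an algebraically nondegenerate holomorphic map into the variety of `I`:
its image is contained in `V` but in no proper algebraic subvariety of `V`. -/
def AlgNondeg {K : ℕ} (f : Fin K → ℂ → ℂ) (I : Ideal (MvPolynomial (Fin K) ℂ)) : Prop :=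
  MapsIntoCone f I ∧
  ∀ P : MvPolynomial (Fin K) ℂ, (∃ e, P.IsHomogeneous e) → P ∉ I →
    ∃ z, polyComp P f z ≠ 0

/-- `P r` holds for all `r ∈ [1,∞)` outside a Borel subset `E` of `(1,∞)` of finite
Lebesgue measure. -/
def ExcSMT (P : ℝ → Prop) : Prop :=
  ∃ E : Set ℝ, MeasurableSet E ∧ E ⊆ Set.Ioi 1 ∧ MeasureTheory.volume E < ⊤ ∧
    ∀ r : ℝ, 1 ≤ r → r ∉ E → P r

namespace NochkaAux

variable {ι : Type*} [DecidableEq ι]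

/-- any independent set inside `A` extends to one of full rank. -/
lemma exists_basis (c : Finset ι → ℕ)
    (hmono : ∀ A B, A ⊆ B → c A ≤ c B)
    (hunit : ∀ A i, c (insert i A) ≤ c A + 1)
    (hclos : ∀ J T, c J = J.card → (∀ i ∈ T, c (insert i J) = c J) → c (J ∪ T) = c J)
    (A J : Finset ι) (hJA : J ⊆ A) (hJ : c J = J.card) :
    ∃ J', J ⊆ J' ∧ J' ⊆ A ∧ c J' = J'.card ∧ c J' = c A := by
  induction h : A.card - J.card using Nat.strong_induction_on generalizing J with
  | _ k ih =>
    by_cases hex : ∃ i ∈ A, c (insert i J) ≠ c J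
    · obtain ⟨i, hiA, hi⟩ := hex
      have hiJ : i ∉ J := by
        intro hiJ
        rw [Finset.insert_eq_of_mem hiJ] at hi
        exact hi rfl
      have h1 := hunit J i
      have h2 := hmono J (insert i J) (Finset.subset_insert _ _)
      have h3 : (insert i J).card = J.card + 1 := Finset.card_insert_of_notMem hiJ
      have h4 : insert i J ⊆ A := Finset.insert_subset hiA hJA
      have h5 := Finset.card_le_card h4
      obtain ⟨J', a, b, d, e⟩ := ih (A.card - (insert i J).card) (by omega) (insert i J) h4
        (by omega) rfl
      exact ⟨J', (Finset.subset_insert _ _).trans a, b, d, e⟩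
    · push Not at hex
      refine ⟨J, subset_rfl, hJA, hJ, ?_⟩
      rw [← hclos J A hJ hex, Finset.union_eq_right.mpr hJA]

lemma card_bound (c : Finset ι → ℕ) (h0 : c ∅ = 0)
    (hunit : ∀ A i, c (insert i A) ≤ c A + 1) (A : Finset ι) : c A ≤ A.card := by
  induction A using Finset.induction_on with
  | empty => simp [h0]
  | insert i s hi ih =>
    have := hunit s i
    rw [Finset.card_insert_of_notMem hi]; omega

/-- subsets of independent sets are independent -/
lemma indep_subset (c : Finset ι → ℕ) (h0 : c ∅ = 0)
    (hunit : ∀ A i, c (insert i A) ≤ c A + 1) (J K : Finset ι) (hJK : J ⊆ K)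
    (hK : c K = K.card) : c J = J.card := by
  have h1 : ∀ T : Finset ι, c (J ∪ T) ≤ c J + T.card := by
    intro T
    induction T using Finset.induction_on with
    | empty => simp
    | insert i s hi ih =>
      have := hunit (J ∪ s) i
      rw [Finset.card_insert_of_notMem hi, Finset.union_insert]; omega
  have h2 := h1 (K \ J)
  rw [Finset.union_sdiff_of_subset hJK] at h2
  have h3 := Finset.card_sdiff_add_card_eq_card hJK
  have h4 := card_bound c h0 hunit J
  omega

lemma submod (c : Finset ι → ℕ) (h0 : c ∅ = 0)
    (hmono : ∀ A B, A ⊆ B → c A ≤ c B)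
    (hunit : ∀ A i, c (insert i A) ≤ c A + 1)
    (hclos : ∀ J T, c J = J.card → (∀ i ∈ T, c (insert i J) = c J) → c (J ∪ T) = c J)
    (A B : Finset ι) : c (A ∪ B) + c (A ∩ B) ≤ c A + c B := by
  have hher := indep_subset c h0 hunit
  obtain ⟨I0, -, hI0, hI0c, hI0e⟩ := exists_basis c hmono hunit hclos (A ∩ B) ∅ (by simp)
    (by simp [h0])
  obtain ⟨I2, h02, hI2, hI2c, hI2e⟩ := exists_basis c hmono hunit hclos (A ∪ B) I0
    (hI0.trans (Finset.inter_subset_left.trans Finset.subset_union_left)) hI0c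
  have e1 := Finset.card_union_add_card_inter (I2 ∩ A) (I2 ∩ B)
  have e2 : I2 ∩ A ∪ I2 ∩ B = I2 := by
    rw [← Finset.inter_union_distrib_left]; exact Finset.inter_eq_left.mpr hI2
  have e3 : I0 ⊆ (I2 ∩ A) ∩ (I2 ∩ B) := by
    intro x hx
    have := hI0 hx
    have := h02 hx
    simp_all
  have e4 := Finset.card_le_card e3
  have e5 := hher _ _ (Finset.inter_subset_left (s₁ := I2) (s₂ := A)) hI2c
  have e6 := hher _ _ (Finset.inter_subset_left (s₁ := I2) (s₂ := B)) hI2c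
  have e7 := hmono _ _ (Finset.inter_subset_right (s₁ := I2) (s₂ := A))
  have e8 := hmono _ _ (Finset.inter_subset_right (s₁ := I2) (s₂ := B))
  rw [e2] at e1
  omega

lemma nullity {q n N : ℕ} (hq : N + 1 ≤ q) (c : Finset (Fin q) → ℕ)
    (hmono : ∀ A B, A ⊆ B → c A ≤ c B)
    (hunit : ∀ A i, c (insert i A) ≤ c A + 1)
    (hfull : ∀ R, R.card = N + 1 → c R = n + 1)
    (R : Finset (Fin q)) (hR : c R ≤ n) : R.card + n ≤ N + c R := by
  have hbig : ∀ R : Finset (Fin q), N + 1 ≤ R.card → n + 1 ≤ c R := by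
    intro R hR
    obtain ⟨T, hT, hTc⟩ := Finset.exists_subset_card_eq hR
    rw [← hfull T hTc]
    exact hmono _ _ hT
  induction h : q - R.card using Nat.strong_induction_on generalizing R with
  | _ k ih =>
    by_cases hu : R = Finset.univ
    · have := hbig R (by rw [hu]; simpa using hq)
      omega
    · obtain ⟨i, hi⟩ : ∃ i, i ∉ R := by
        by_contra hcon
        push Not at hcon
        exact hu (Finset.eq_univ_iff_forall.mpr hcon)
      have h3 := Finset.card_insert_of_notMem hi
      have h1 := hunit R i
      have h2 := hmono R (insert i R) (Finset.subset_insert _ _)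
      have h4 : (insert i R).card ≤ q := by simpa using Finset.card_le_univ (insert i R)
      by_cases hc : c (insert i R) ≤ n
      · have := ih _ (by omega) (insert i R) hc rfl
        omega
      · by_contra hcon
        have := hbig R (by omega)
        omega

/-- vectors in the base polytope of `c` restricted to `X`, truncated by `Θ`. -/
lemma base_vector {ι : Type*} [DecidableEq ι] [Fintype ι] (c : Finset ι → ℕ) (h0 : c ∅ = 0)
    (hpos : ∀ A, A.Nonempty → 1 ≤ c A)
    (hsub : ∀ A B, c (A ∪ B) + c (A ∩ B) ≤ c A + c B)
    (X : Finset ι) (Θ ε : ℝ) (hε : 0 < ε) (hεΘ : ε ≤ Θ) (hεc : ε * Fintype.card ι ≤ 1)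
    (hX : ∀ R, R ⊆ X → (c X : ℝ) - Θ * X.card ≤ c R - Θ * R.card) :
    ∃ ω : ι → ℝ, (∀ j, ε ≤ ω j ∧ ω j ≤ Θ) ∧ (∀ R, R ⊆ X → ∑ j ∈ R, ω j ≤ c R) ∧
      ∑ j ∈ X, ω j = c X := by
  let P : Set (ι → ℝ) := Set.Icc (fun _ => ε) (fun _ => Θ) ∩
    ⋂ R : Finset ι, ⋂ _ : R ⊆ X, {ω | ∑ j ∈ R, ω j ≤ c R}
  have hPc : IsCompact P := by
    apply IsCompact.inter_right isCompact_Icc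
    refine isClosed_iInter fun R => isClosed_iInter fun _ => ?_
    exact isClosed_le (by fun_prop) continuous_const
  have hPmem : ∀ ω, ω ∈ P ↔ (∀ j, ε ≤ ω j ∧ ω j ≤ Θ) ∧ (∀ R, R ⊆ X → ∑ j ∈ R, ω j ≤ c R) := by
    intro ω
    simp [P, Pi.le_def, forall_and]
  have hPne : P.Nonempty := by
    refine ⟨fun _ => ε, (hPmem _).2 ⟨fun _ => ⟨le_rfl, hεΘ⟩, fun R _ => ?_⟩⟩
    rcases R.eq_empty_or_nonempty with rfl | hR
    · simp
    · have h1 : (1 : ℝ) ≤ c R := by exact_mod_cast hpos R hR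
      have h2 : (R.card : ℝ) ≤ Fintype.card ι := by exact_mod_cast Finset.card_le_univ R
      simp only [Finset.sum_const, nsmul_eq_mul]
      nlinarith
  obtain ⟨ω, hωP, hmax⟩ := hPc.exists_isMaxOn hPne
    (f := fun ω => ∑ j ∈ X, ω j) (by fun_prop)
  have hω := (hPmem ω).1 hωP
  refine ⟨ω, hω.1, hω.2, ?_⟩
  -- tight sets
  have htu : ∀ A B, A ⊆ X → B ⊆ X → ∑ j ∈ A, ω j = c A → ∑ j ∈ B, ω j = c B →
      ∑ j ∈ A ∪ B, ω j = c (A ∪ B) := by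
    intro A B hA hB hA' hB'
    have h1 := Finset.sum_union_inter (s₁ := A) (s₂ := B) (f := ω)
    have h2 : (c (A ∪ B) : ℝ) + c (A ∩ B) ≤ c A + c B := by exact_mod_cast hsub A B
    have h3 := hω.2 (A ∩ B) (Finset.inter_subset_left.trans hA)
    have h4 := hω.2 (A ∪ B) (Finset.union_subset hA hB)
    linarith
  have htight : ∀ j ∈ X, ω j < Θ → ∃ A, A ⊆ X ∧ j ∈ A ∧ ∑ j ∈ A, ω j = c A := by
    intro j hj hjΘ
    by_contra hcon
    push Not at hcon
    -- slack
    obtain ⟨δ, hδ, hδ1, hδ2⟩ : ∃ δ : ℝ, 0 < δ ∧ ω j + δ ≤ Θ ∧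
        ∀ A, A ⊆ X → j ∈ A → ∑ j ∈ A, ω j + δ ≤ c A := by
      let F : Finset (Finset ι) := X.powerset.filter (j ∈ ·)
      have hF : F.Nonempty := ⟨X, by simp [F, hj]⟩
      obtain ⟨A0, hA0, hmin⟩ := F.exists_min_image (fun A => (c A : ℝ) - ∑ j ∈ A, ω j) hF
      simp only [F, Finset.mem_filter, Finset.mem_powerset] at hA0 hmin
      refine ⟨min (Θ - ω j) ((c A0 : ℝ) - ∑ j ∈ A0, ω j), ?_, ?_, ?_⟩
      · refine lt_min (by linarith) ?_
        have h1 := hω.2 A0 hA0.1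
        have h2 := hcon A0 hA0.1 hA0.2
        have := lt_of_le_of_ne h1 h2
        linarith
      · have := min_le_left (Θ - ω j) ((c A0 : ℝ) - ∑ j ∈ A0, ω j)
        linarith
      · intro A hA hjA
        have := min_le_right (Θ - ω j) ((c A0 : ℝ) - ∑ j ∈ A0, ω j)
        have := hmin A ⟨hA, hjA⟩
        linarith
    have hsum : ∀ R : Finset ι, ∑ i ∈ R, (ω i + if i = j then δ else 0) =
        ∑ i ∈ R, ω i + if j ∈ R then δ else 0 := by
      intro R
      rw [Finset.sum_add_distrib, Finset.sum_ite_eq']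
    have hmem : (fun i => ω i + if i = j then δ else 0) ∈ P := by
      refine (hPmem _).2 ⟨fun i => ?_, fun R hR => ?_⟩
      · have := hω.1 i
        by_cases hij : i = j
        · subst hij; simp only [if_true]; constructor <;> linarith
        · simpa [hij] using this
      · rw [hsum]
        by_cases hjR : j ∈ R
        · simpa [hjR] using hδ2 R hR hjR
        · simpa [hjR] using hω.2 R hR
    have := hmax hmem
    simp only [Set.mem_ofPred_eq] at this
    rw [hsum X] at this
    simp only [hj, if_true] at this
    linarith
  -- maximal tight set
  obtain ⟨T, hTX, hT, hTmax⟩ : ∃ T, T ⊆ X ∧ ∑ j ∈ T, ω j = c T ∧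
      ∀ A, A ⊆ X → ∑ j ∈ A, ω j = c A → A ⊆ T := by
    let F : Finset (Finset ι) := X.powerset.filter (fun A => ∑ j ∈ A, ω j = c A)
    have hF : F.Nonempty := ⟨∅, by simp [F, h0]⟩
    obtain ⟨T, hT, hTm⟩ := F.exists_max_image Finset.card hF
    simp only [F, Finset.mem_filter, Finset.mem_powerset] at hT hTm
    refine ⟨T, hT.1, hT.2, fun A hA hA' => ?_⟩
    have h1 := hTm (T ∪ A) ⟨Finset.union_subset hT.1 hA, htu T A hT.1 hA hT.2 hA'⟩
    have h2 := Finset.eq_of_subset_of_card_le (Finset.subset_union_left (s₁ := T) (s₂ := A)) h1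
    rw [h2]; exact Finset.subset_union_right
  have hout : ∀ j ∈ X \ T, ω j = Θ := by
    intro j hj
    rw [Finset.mem_sdiff] at hj
    by_contra hne
    obtain ⟨A, hA, hjA, hAt⟩ := htight j hj.1 (lt_of_le_of_ne (hω.1 j).2 hne)
    exact hj.2 (hTmax A hA hAt hjA)
  have e1 := Finset.sum_sdiff hTX (f := ω)
  rw [Finset.sum_congr rfl hout, hT, Finset.sum_const, nsmul_eq_mul] at e1
  have e2 : ((X \ T).card : ℝ) + T.card = X.card := by
    exact_mod_cast Finset.card_sdiff_add_card_eq_card hTX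
  have e3 := hX T hTX
  have e4 := hω.2 X subset_rfl
  have e5 : ((X \ T).card : ℝ) = X.card - T.card := by linarith
  rw [e5] at e1
  nlinarith

/-- combinatorial Nochka weights. -/
lemma nochka {q n N : ℕ} (hNn : n ≤ N) (hq : 2 * N - n + 1 ≤ q) (c : Finset (Fin q) → ℕ)
    (h0 : c ∅ = 0) (h1 : ∀ i, 1 ≤ c {i}) (hle : ∀ R, c R ≤ n + 1)
    (hmono : ∀ A B, A ⊆ B → c A ≤ c B)
    (hunit : ∀ A i, c (insert i A) ≤ c A + 1)
    (hclos : ∀ J T, c J = J.card → (∀ i ∈ T, c (insert i J) = c J) → c (J ∪ T) = c J)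
    (hfull : ∀ R, R.card = N + 1 → c R = n + 1) :
    ∃ (ω : Fin q → ℝ) (Θ : ℝ),
      (∀ j, 0 < ω j ∧ ω j ≤ Θ) ∧ Θ ≤ 1 ∧
      (∑ j, ω j) = Θ * ((q : ℝ) - 2 * N + n - 1) + n + 1 ∧
      ((n : ℝ) + 1) / (2 * (N : ℝ) - (n : ℝ) + 1) ≤ Θ ∧
      Θ ≤ ((n : ℝ) + 1) / ((N : ℝ) + 1) ∧
      ∀ R : Finset (Fin q), 0 < R.card → R.card ≤ N + 1 →
        (∑ j ∈ R, ω j) ≤ (c R : ℝ) := by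
  have hsub := submod c h0 hmono hunit hclos
  have hnull := nullity (by omega) c hmono hunit hfull
  have hpos : ∀ A : Finset (Fin q), A.Nonempty → 1 ≤ c A := by
    rintro A ⟨i, hi⟩
    exact (h1 i).trans (hmono _ _ (by simpa using hi))
  have hcle : ∀ R : Finset (Fin q), c R ≤ R.card := by
    intro A
    induction A using Finset.induction_on with
    | empty => simp [h0]
    | insert i s hi ih =>
      have := hunit s i
      rw [Finset.card_insert_of_notMem hi]; omega
  have hNn' : (n : ℝ) ≤ N := by exact_mod_cast hNn
  have hqr : 2 * (N : ℝ) - n + 1 ≤ q := by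
    have : 2 * N + 1 ≤ q + n := by omega
    have : 2 * (N : ℝ) + 1 ≤ q + n := by exact_mod_cast this
    linarith
  let F : Finset (Finset (Fin q)) := Finset.univ.filter (fun R => c R ≤ n)
  have hF : F.Nonempty := ⟨∅, by simp [F, h0]⟩
  obtain ⟨X, hXF, hXmax⟩ := F.exists_max_image
    (fun R => ((n : ℝ) + 1 - c R) / (2 * N - n + 1 - R.card)) hF
  simp only [F, Finset.mem_filter, Finset.mem_univ, true_and] at hXF hXmax
  set Θ : ℝ := ((n : ℝ) + 1 - c X) / (2 * N - n + 1 - X.card) with hΘ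
  have hnullr : ∀ R, c R ≤ n → (R.card : ℝ) + n ≤ N + c R := fun R hR => by
    exact_mod_cast hnull R hR
  have hcr : ∀ R, c R ≤ n → (c R : ℝ) ≤ n := fun R hR => by exact_mod_cast hR
  have hden : ∀ R, c R ≤ n → (0 : ℝ) < 2 * N - n + 1 - R.card := by
    intro R hR
    have := hnullr R hR
    have := hcr R hR
    linarith
  have hcX := hcr X hXF
  have hnX := hnullr X hXF
  have hdX := hden X hXF
  have hc0 : (0 : ℝ) ≤ c X := Nat.cast_nonneg _
  have hΘeq : Θ * (2 * N - n + 1 - X.card) = n + 1 - c X := by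
    rw [hΘ]; field_simp
  have hΘge : ∀ R, c R ≤ n → (n : ℝ) + 1 - c R ≤ Θ * (2 * N - n + 1 - R.card) := by
    intro R hR
    exact (div_le_iff₀ (hden R hR)).1 (hXmax R hR)
  have hΘpos : 0 < Θ := div_pos (by linarith) hdX
  have hn0 : (0 : ℝ) ≤ n := Nat.cast_nonneg _
  have hΘlow : ((n : ℝ) + 1) / (2 * (N : ℝ) - (n : ℝ) + 1) ≤ Θ := by
    have := hXmax ∅ (by simp [h0])
    simpa [h0] using this
  -- Θ (N - n + k) ≤ k
  have hΘk : Θ * (N + 1 - c X) ≤ n + 1 - c X := by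
    rw [← hΘeq]
    apply mul_le_mul_of_nonneg_left _ hΘpos.le
    linarith
  have hΘup : Θ ≤ ((n : ℝ) + 1) / ((N : ℝ) + 1) := by
    rw [le_div_iff₀ (by linarith)]
    have hle1 : Θ ≤ 1 := by
      by_contra hcon
      push Not at hcon
      nlinarith
    nlinarith
  have hΘ1 : Θ ≤ 1 := hΘup.trans (by rw [div_le_one (by linarith)]; linarith)
  have hq0 : (0 : ℝ) < q := by linarith
  have hεΘ : 1 / (q : ℝ) ≤ Θ := by
    refine le_trans ?_ hΘlow
    rw [div_le_div_iff₀ hq0 (by linarith)]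
    nlinarith
  obtain ⟨w, hw1, hw2, hw3⟩ := base_vector c h0 hpos hsub X Θ (1 / q) (by positivity) hεΘ
    (by simp; field_simp; rfl) (by
      intro R hR
      have := hΘge R ((hmono _ _ hR).trans hXF)
      linarith)
  have hεpos : 0 < 1 / (q : ℝ) := by positivity
  refine ⟨fun j => if j ∈ X then w j else Θ, Θ, ?_, hΘ1, ?_, hΘlow, hΘup, ?_⟩
  · intro j
    by_cases hj : j ∈ X
    · simp only [hj, if_true]
      exact ⟨hεpos.trans_le (hw1 j).1, (hw1 j).2⟩
    · simp [hj, hΘpos]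
  · rw [Finset.sum_ite]
    simp only [Finset.filter_univ_mem, Finset.sum_const, nsmul_eq_mul, hw3]
    have : ((Finset.univ.filter (· ∉ X)).card : ℝ) = q - X.card := by
      have h := Finset.card_filter_add_card_filter_not (s := (Finset.univ : Finset (Fin q))) (· ∈ X)
      simp only [Finset.filter_univ_mem, Finset.card_univ, Fintype.card_fin] at h
      have h' : (X.card : ℝ) + (Finset.univ.filter (· ∉ X)).card = q := by exact_mod_cast h
      linarith
    rw [this]
    linarith
  · intro R _ hRN
    have hsplit : ∑ j ∈ R, (if j ∈ X then w j else Θ) =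
        ∑ j ∈ R ∩ X, w j + Θ * (R.card - (R ∩ X).card) := by
      rw [Finset.sum_ite]
      simp only [Finset.filter_mem_eq_inter, Finset.sum_const, nsmul_eq_mul]
      have h := Finset.card_filter_add_card_filter_not (s := R) (· ∈ X)
      simp only [Finset.filter_mem_eq_inter] at h
      have h' : ((R ∩ X).card : ℝ) + (R.filter (· ∉ X)).card = R.card := by exact_mod_cast h
      rw [← h']
      ring
    rw [hsplit]
    have hRX := hw2 (R ∩ X) Finset.inter_subset_right
    by_cases hRn : c R ≤ n
    · have hs : (c (R ∪ X) : ℝ) + c (R ∩ X) ≤ c R + c X := by exact_mod_cast hsub R X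
      have hcard : ((R ∪ X).card : ℝ) + (R ∩ X).card = R.card + X.card := by
        exact_mod_cast Finset.card_union_add_card_inter R X
      by_cases hU : c (R ∪ X) ≤ n
      · have h2 := hΘge _ hU
        have h3 : ((R ∪ X).card : ℝ) = R.card + X.card - (R ∩ X).card := by linarith
        rw [h3] at h2
        nlinarith
      · have hU' : c (R ∪ X) = n + 1 := le_antisymm (hle _) (by omega)
        rw [hU'] at hs
        push_cast at hs
        have h2 := hnullr R hRn
        have h3 : (c (R ∩ X) : ℝ) ≤ (R ∩ X).card := by exact_mod_cast hcle _
        -- r = c R - c (R ∩ X) ≥ k = n + 1 - c X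
        have h4 : Θ * (R.card - (R ∩ X).card) ≤ Θ * (N - n + (c R - c (R ∩ X))) :=
          mul_le_mul_of_nonneg_left (by linarith) hΘpos.le
        have h5 : 0 ≤ (c R : ℝ) - c (R ∩ X) - (n + 1 - c X) := by linarith
        have h6 := mul_le_mul_of_nonneg_right hΘ1 h5
        linarith
    · have hc : c R = n + 1 := le_antisymm (hle _) (by omega)
      have h2 : ∑ j ∈ R ∩ X, w j ≤ Θ * (R ∩ X).card := by
        have := Finset.sum_le_card_nsmul (R ∩ X) w Θ (fun j _ => (hw1 j).2)
        rw [nsmul_eq_mul] at this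
        linarith
      have h3 : (R.card : ℝ) ≤ N + 1 := by exact_mod_cast hRN
      rw [hc]
      push_cast
      rw [le_div_iff₀ (by linarith)] at hΘup
      have h4 := mul_le_mul_of_nonneg_left h3 hΘpos.le
      linarith

end NochkaAux

section Geometry

variable {K : ℕ}

/-- ideals generated by homogeneous polynomials -/
def HomId (a : Ideal (MvPolynomial (Fin K) ℂ)) : Prop :=
  ∃ S : Set (MvPolynomial (Fin K) ℂ), (∀ Q ∈ S, ∃ e, Q.IsHomogeneous e) ∧ a = Ideal.span S

lemma HomId.sup {a b : Ideal (MvPolynomial (Fin K) ℂ)} (ha : HomId a) (hb : HomId b) :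
    HomId (a ⊔ b) := by
  obtain ⟨S, hS, rfl⟩ := ha
  obtain ⟨T, hT, rfl⟩ := hb
  refine ⟨S ∪ T, ?_, (Ideal.span_union S T).symm⟩
  rintro Q (h | h)
  · exact hS Q h
  · exact hT Q h

lemma HomId.comp_mem {a : Ideal (MvPolynomial (Fin K) ℂ)} (ha : HomId a)
    {p : MvPolynomial (Fin K) ℂ} (hp : p ∈ a) (m : ℕ) : homogeneousComponent m p ∈ a := by
  let := MvPolynomial.gradedAlgebra (σ := Fin K) (R := ℂ)
  obtain ⟨S, hS, rfl⟩ := ha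
  refine MvPolynomial.homogeneousComponent_mem_of_mem ?_ hp m
  exact Ideal.homogeneous_span _ _ hS

lemma vIdeal_coneOf (a : Ideal (MvPolynomial (Fin K) ℂ)) : vIdeal (coneOf a) = a.radical := by
  rw [← MvPolynomial.vanishingIdeal_zeroLocus_eq_radical (K := ℂ)]
  rfl

lemma dim_le_iff {R : Type*} [CommRing R] (a : Ideal R) (d : ℕ) :
    ringKrullDim (R ⧸ a) ≤ d ↔
      ∀ l : LTSeries (PrimeSpectrum R), a ≤ l.head.asIdeal → l.length ≤ d := by
  rw [ringKrullDim_quotient, Order.krullDim, iSup_le_iff]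
  constructor
  · intro h l hl
    have hmem : ∀ i, l i ∈ PrimeSpectrum.zeroLocus (a : Set R) := by
      intro i
      have : l.head ≤ l i := LTSeries.head_le l i
      exact (show (a : Set R) ⊆ l.head.asIdeal from hl).trans this
    let l' : LTSeries (PrimeSpectrum.zeroLocus (a : Set R)) :=
      ⟨l.length, fun i => ⟨l i, hmem i⟩, fun i => l.step i⟩
    have := h l'
    exact_mod_cast this
  · intro h l
    have := h (l.map Subtype.val (fun _ _ h => h)) (show (a : Set R) ⊆ (l.head).1.asIdeal from l.head.2)
    exact_mod_cast this

lemma head_lt_last' {α : Type*} [Preorder α] (l : LTSeries α) (h : 0 < l.length) :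
    l.head < l.last :=
  l.strictMono (by rw [Fin.lt_def]; simpa using h)

lemma dim_radical (a : Ideal (MvPolynomial (Fin K) ℂ)) :
    ringKrullDim (MvPolynomial (Fin K) ℂ ⧸ a.radical) =
      ringKrullDim (MvPolynomial (Fin K) ℂ ⧸ a) := by
  rw [ringKrullDim_quotient, ringKrullDim_quotient, PrimeSpectrum.zeroLocus_radical]

lemma dim_poly (d : ℕ) : ringKrullDim (MvPolynomial (Fin d) ℂ) = (d : WithBot ℕ∞) := by
  rw [MvPolynomial.ringKrullDim_of_isNoetherianRing]
  simp

lemma toNat_unbot_le_iff (x : WithBot ℕ∞) (m d : ℕ) (hx : x ≤ m) :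
    ENat.toNat (x.unbotD 0) ≤ d ↔ x ≤ d := by
  induction x with
  | bot => simp
  | coe y =>
    induction y with
    | top =>
      exfalso
      have : (⊤ : ℕ∞) ≤ (m : ℕ∞) := by exact_mod_cast hx
      simp at this
    | coe k => simp

lemma coneDim_le_iff (A : Set (Fin K → ℂ)) (d : ℕ) :
    coneDim A ≤ d ↔ ringKrullDim (MvPolynomial (Fin K) ℂ ⧸ vIdeal A) ≤ d :=
  toNat_unbot_le_iff _ K d ((ringKrullDim_quotient_le _).trans (dim_poly K).le)

lemma coneDim_coneOf_le_iff (a : Ideal (MvPolynomial (Fin K) ℂ)) (d : ℕ) :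
    coneDim (coneOf a) ≤ d ↔ ringKrullDim (MvPolynomial (Fin K) ℂ ⧸ a) ≤ d := by
  rw [coneDim_le_iff, vIdeal_coneOf, dim_radical]

lemma coneDim_mono {A B : Set (Fin K → ℂ)} (h : A ⊆ B) : coneDim A ≤ coneDim B := by
  rw [coneDim_le_iff]
  refine le_trans ?_ ((coneDim_le_iff B _).1 le_rfl)
  have : vIdeal B ≤ vIdeal A := fun Q hQ x hx => hQ x (h hx)
  exact ringKrullDim_le_of_surjective (Ideal.Quotient.factor this)
    (Ideal.Quotient.factor_surjective this)

/-- Primes containing all the variables are maximal. -/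
lemma eq_of_X_mem {p q : Ideal (MvPolynomial (Fin K) ℂ)} (hq : q.IsPrime) (hpq : p ≤ q)
    (hX : ∀ i, X i ∈ p) : q ≤ p := by
  have key : (Ideal.Quotient.mk p) = ((Ideal.Quotient.mk p).comp C).comp (eval 0) := by
    apply MvPolynomial.ringHom_ext
    · intro r; simp
    · intro i
      simpa using Ideal.Quotient.eq_zero_iff_mem.2 (hX i)
  have key' : ∀ g, g - C (eval 0 g) ∈ p := fun g => by
    rw [← Ideal.Quotient.eq_zero_iff_mem, map_sub, sub_eq_zero]
    exact congrArg (fun φ => φ g) key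
  intro g hg
  have h1 := hpq (key' g)
  have h2 : C (eval 0 g) ∈ q := by
    have := q.sub_mem hg h1
    simpa using this
  have h3 : eval 0 g = 0 := by
    by_contra hne
    apply hq.ne_top
    refine Ideal.eq_top_of_isUnit_mem _ h2 ?_
    exact (isUnit_iff_ne_zero.2 hne).map C
  have h4 := key' g
  rw [h3] at h4
  simpa using h4

lemma coneDim_of_subset_zero {A : Set (Fin K → ℂ)} (h : ∀ x ∈ A, x = 0) : coneDim A = 0 := by
  rw [← Nat.le_zero, coneDim_le_iff, dim_le_iff]
  intro l hl
  have hX : ∀ i, X i ∈ l.head.asIdeal := fun i => hl (fun x hx => by simp [h x hx])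
  by_contra hcon
  have h0 : 0 < l.length := by omega
  have h1 : l.head < l.last := head_lt_last' l h0
  exact not_le_of_gt h1 (eq_of_X_mem l.last.isPrime h1.le hX)

lemma eval_smul_hom {g : MvPolynomial (Fin K) ℂ} {e : ℕ} (hg : g.IsHomogeneous e) (t : ℂ)
    (x : Fin K → ℂ) : eval (fun i => x i * t) g = eval x g * t ^ e := by
  rw [eval_eq', eval_eq', Finset.sum_mul]
  refine Finset.sum_congr rfl fun m hm => ?_
  have : ∑ i, m i = e := by
    rw [← Finsupp.degree_eq_sum]
    exact (hg.degree_eq_sum_deg_support hm).symm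
  rw [← this, ← Finset.prod_pow_eq_pow_sum]
  simp only [mul_pow, Finset.prod_mul_distrib]
  ring

lemma zero_of_dim_zero {a : Ideal (MvPolynomial (Fin K) ℂ)} (ha : HomId a)
    (hd : ringKrullDim (MvPolynomial (Fin K) ℂ ⧸ a) ≤ (0 : ℕ)) (x : Fin K → ℂ)
    (hx : x ∈ coneOf a) : x = 0 := by
  by_contra hne
  obtain ⟨i, hi⟩ : ∃ i, x i ≠ 0 := by
    by_contra hcon; push Not at hcon; exact hne (funext hcon)
  rw [dim_le_iff] at hd
  let φ : MvPolynomial (Fin K) ℂ →ₐ[ℂ] Polynomial ℂ :=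
    aeval (fun i => Polynomial.C (x i) * Polynomial.X)
  have hφ : ∀ t g, Polynomial.eval t (φ g) = eval (fun i => x i * t) g := by
    intro t g
    have : ((Polynomial.evalRingHom t).comp φ.toRingHom) = eval (fun i => x i * t) := by
      apply MvPolynomial.ringHom_ext
      · intro r; simp [φ]
      · intro i; simp [φ]
    exact congrArg (fun ψ => ψ g) this
  let p0 : PrimeSpectrum (MvPolynomial (Fin K) ℂ) := ⟨RingHom.ker φ.toRingHom, RingHom.ker_isPrime _⟩
  let p1 : PrimeSpectrum (MvPolynomial (Fin K) ℂ) := ⟨RingHom.ker (eval x), RingHom.ker_isPrime _⟩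
  have hle : a ≤ p0.asIdeal := by
    obtain ⟨S, hS, rfl⟩ := ha
    rw [Ideal.span_le]
    intro g hg
    obtain ⟨e, he⟩ := hS g hg
    have h0 : eval x g = 0 := hx g (Ideal.subset_span hg)
    change φ g = 0
    apply Polynomial.funext
    intro t
    rw [hφ, eval_smul_hom he, h0]
    simp
  have hlt : p0 < p1 := by
    refine lt_of_le_of_ne ?_ ?_
    · intro g hg
      have hg' : φ g = 0 := hg
      change eval x g = 0
      have := hφ 1 g
      rw [hg'] at this
      simpa using this.symm
    · intro heq
      have h1 : (X i - C (x i) : MvPolynomial (Fin K) ℂ) ∈ p1.asIdeal := by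
        change eval x _ = 0
        simp
      rw [← heq] at h1
      have h2 : φ (X i - C (x i)) = 0 := h1
      have h3 := hφ 0 (X i - C (x i))
      rw [h2] at h3
      simp at h3
      exact hi h3
  let l : LTSeries (PrimeSpectrum (MvPolynomial (Fin K) ℂ)) :=
    ⟨1, ![p0, p1], by intro i; fin_cases i; exact hlt⟩
  have h5 : l.length ≤ 0 := hd l hle
  exact absurd h5 (by simp [l])

/-- dimension drops when cutting by a polynomial in no relevant minimal prime. -/
lemma dim_cut_le {a : Ideal (MvPolynomial (Fin K) ℂ)} {d : ℕ}
    (hd : ringKrullDim (MvPolynomial (Fin K) ℂ ⧸ a) ≤ (d + 1 : ℕ)) (g : MvPolynomial (Fin K) ℂ)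
    (hg : ∀ p ∈ a.minimalPrimes, (∀ i, X i ∈ p) ∨ g ∉ p) :
    ringKrullDim (MvPolynomial (Fin K) ℂ ⧸ (a ⊔ Ideal.span {g})) ≤ (d : ℕ) := by
  rw [dim_le_iff] at hd ⊢
  intro l hl
  obtain ⟨p, hp, hpl⟩ := Ideal.exists_minimalPrimes_le (I := a) (J := l.head.asIdeal)
    (le_sup_left.trans hl)
  rcases hg p hp with hX | hgp
  · by_contra hcon
    have h1 : l.head < l.last := head_lt_last' l (by omega)
    exact not_le_of_gt h1 ((eq_of_X_mem l.last.isPrime (hpl.trans h1.le) hX).trans hpl)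
  · let p' : PrimeSpectrum (MvPolynomial (Fin K) ℂ) := ⟨p, hp.1.1⟩
    have hlt : p' < l.head := by
      refine lt_of_le_of_ne hpl ?_
      intro heq
      apply hgp
      change g ∈ p'.asIdeal
      rw [heq]
      exact hl (Ideal.mem_sup_right (Ideal.mem_span_singleton_self g))
    have := hd (l.cons p' hlt) (by simpa using hp.1.2)
    simp at this
    exact this

lemma exists_linear (a : Ideal (MvPolynomial (Fin K) ℂ)) :
    ∃ g : MvPolynomial (Fin K) ℂ, g.IsHomogeneous 1 ∧
      ∀ p ∈ a.minimalPrimes, (∀ i, X i ∈ p) ∨ g ∉ p := by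
  classical
  let L : (Fin K → ℂ) →ₗ[ℂ] MvPolynomial (Fin K) ℂ :=
    Fintype.linearCombination ℂ (fun i => (X i : MvPolynomial (Fin K) ℂ))
  let U : Ideal (MvPolynomial (Fin K) ℂ) → Submodule ℂ (Fin K → ℂ) :=
    fun p => (p.restrictScalars ℂ).comap L
  have hfin := Ideal.finite_minimalPrimes_of_isNoetherianRing (MvPolynomial (Fin K) ℂ) a
  let s : Finset (Submodule ℂ (Fin K → ℂ)) := (hfin.toFinset.image U).erase ⊤
  have hs : ⊤ ∉ s := by simp [s]
  have hne := Subspace.biUnion_ne_univ_of_top_notMem hs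
  obtain ⟨v, hv⟩ := (Set.ne_univ_iff_exists_notMem _).1 hne
  refine ⟨L v, ?_, ?_⟩
  · rw [Fintype.linearCombination_apply]
    refine IsHomogeneous.sum _ _ _ fun i _ => ?_
    rw [smul_eq_C_mul]
    exact isHomogeneous_C_mul_X _ _
  · intro p hp
    by_cases hU : U p = ⊤
    · left
      intro i
      have : Pi.single i 1 ∈ U p := by rw [hU]; trivial
      have h2 : L (Pi.single i 1) ∈ p := this
      simpa [L] using h2
    · right
      intro hmem
      apply hv
      simp only [Set.mem_iUnion]
      exact ⟨U p, by simp only [s, Finset.mem_erase, Finset.mem_image, Set.Finite.mem_toFinset]; exact ⟨hU, p, hp, rfl⟩, hmem⟩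

lemma mem_coneOf_sup_singleton (a : Ideal (MvPolynomial (Fin K) ℂ)) (g : MvPolynomial (Fin K) ℂ)
    (x : Fin K → ℂ) : x ∈ coneOf (a ⊔ Ideal.span {g}) ↔ x ∈ coneOf a ∧ eval x g = 0 := by
  constructor
  · intro h
    exact ⟨fun Q hQ => h Q (Ideal.mem_sup_left hQ),
      h g (Ideal.mem_sup_right (Ideal.mem_span_singleton_self g))⟩
  · rintro ⟨h1, h2⟩ Q hQ
    have : a ⊔ Ideal.span {g} ≤ RingHom.ker (eval x) := by
      refine sup_le (fun Q hQ => h1 Q hQ) ?_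
      rw [Ideal.span_le]
      simpa using h2
    exact this hQ

/-- cutting down to the origin by linear forms. -/
lemma exists_cut (d : ℕ) (a : Ideal (MvPolynomial (Fin K) ℂ)) (ha : HomId a)
    (hd : ringKrullDim (MvPolynomial (Fin K) ℂ ⧸ a) ≤ (d : ℕ)) :
    ∃ f : Fin d → MvPolynomial (Fin K) ℂ, (∀ k, (f k).IsHomogeneous 1) ∧
      ∀ x ∈ coneOf a, (∀ k, eval x (f k) = 0) → x = 0 := by
  induction d generalizing a with
  | zero => exact ⟨fun _ => 0, fun k => k.elim0, fun x hx _ => zero_of_dim_zero ha hd x hx⟩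
  | succ d ih =>
    obtain ⟨g, hg, hgp⟩ := exists_linear a
    obtain ⟨f, hf, hcut⟩ := ih (a ⊔ Ideal.span {g})
      (ha.sup ⟨{g}, by rintro Q rfl; exact ⟨1, hg⟩, rfl⟩) (dim_cut_le hd g hgp)
    refine ⟨Fin.cons g f, ?_, ?_⟩
    · intro k
      refine Fin.cases ?_ ?_ k
      · simpa using hg
      · intro k; simpa using hf k
    · intro x hx hk
      refine hcut x ((mem_coneOf_sup_singleton a g x).2 ⟨hx, by simpa using hk 0⟩) ?_
      intro k
      simpa using hk k.succ

lemma X_pow_le (b : Ideal (MvPolynomial (Fin K) ℂ)) (hb : ∀ x ∈ coneOf b, x = 0) :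
    ∃ k : ℕ, ∀ e, k ≤ e → ∀ g : MvPolynomial (Fin K) ℂ, g.IsHomogeneous e → g ∈ b := by
  have h1 : Ideal.span (Set.range (X : Fin K → MvPolynomial (Fin K) ℂ)) ≤ b.radical := by
    rw [Ideal.span_le]
    rintro _ ⟨i, rfl⟩
    rw [← vIdeal_coneOf]
    intro x hx
    simp [hb x hx]
  obtain ⟨k, hk⟩ := Ideal.exists_pow_le_of_le_radical_of_fg h1 (IsNoetherian.noetherian _)
  refine ⟨k, fun e he g hg => ?_⟩
  apply hk
  apply Ideal.pow_le_pow_right he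
  rw [Ideal.mem_span_pow_iff_exists_isHomogeneous]
  refine ⟨map C g, hg.map C, ?_⟩
  rw [eval_map]
  exact eval₂_eta g

lemma comp_mul_mem {V : Type*} [AddCommMonoid V] (W : AddSubmonoid V)
    (φ : MvPolynomial (Fin K) ℂ →+ V) (h f : MvPolynomial (Fin K) ℂ) (e0 e : ℕ)
    (hf : f.IsHomogeneous e0)
    (H : ∀ e', e' + e0 = e → ∀ h' : MvPolynomial (Fin K) ℂ, h'.IsHomogeneous e' → φ (h' * f) ∈ W) :
    φ (homogeneousComponent e (h * f)) ∈ W := by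
  have hs : h * f = ∑ j ∈ Finset.range (h.totalDegree + 1), homogeneousComponent j h * f := by
    rw [← Finset.sum_mul, sum_homogeneousComponent h]
  rw [hs, map_sum, map_sum]
  refine sum_mem fun j _ => ?_
  have hm := (homogeneousComponent_isHomogeneous j h).mul hf
  rw [homogeneousComponent_of_mem ((mem_homogeneousSubmodule _ _).2 hm)]
  split_ifs with hj
  · exact H j hj.symm _ (homogeneousComponent_isHomogeneous j h)
  · simp

lemma dim_le_of_cut_aux {d : ℕ} {a : Ideal (MvPolynomial (Fin K) ℂ)} (ha : HomId a)
    {B : Type} [CommRing B] (mk : MvPolynomial (Fin K) ℂ →+* B) (hmk : Function.Surjective mk)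
    (hker : ∀ g ∈ a, mk g = 0)
    (f : Fin d → MvPolynomial (Fin K) ℂ) (e : Fin d → ℕ) (he : ∀ k, 1 ≤ e k)
    (hf : ∀ k, (f k).IsHomogeneous (e k))
    (hcut : ∀ x ∈ coneOf a, (∀ k, eval x (f k) = 0) → x = 0) :
    ringKrullDim B ≤ (d : ℕ) := by
  classical
  obtain ⟨k, hk⟩ := X_pow_le (a ⊔ Ideal.span (Set.range f)) (by
    intro x hx
    exact hcut x (fun Q hQ => hx Q (Ideal.mem_sup_left hQ))
      (fun k => hx _ (Ideal.mem_sup_right (Ideal.subset_span ⟨k, rfl⟩))))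
  let ψ : MvPolynomial (Fin d) ℂ →+* B :=
    mk.comp (aeval f : MvPolynomial (Fin d) ℂ →ₐ[ℂ] MvPolynomial (Fin K) ℂ).toRingHom
  let : Algebra (MvPolynomial (Fin d) ℂ) B := ψ.toAlgebra
  have hsmul : ∀ (y : MvPolynomial (Fin d) ℂ) (g : MvPolynomial (Fin K) ℂ),
      y • mk g = mk (aeval f y * g) := by
    intro y g
    rw [Algebra.smul_def, map_mul]
    rfl
  let G : Set B :=
    (fun m : Fin K →₀ ℕ => mk (monomial m 1)) '' {m | m.degree ≤ k}
  have hG : G.Finite := (Finsupp.finite_of_degree_le k).image _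
  let W : Submodule (MvPolynomial (Fin d) ℂ) B := Submodule.span _ G
  have hW : ∀ E, ∀ g : MvPolynomial (Fin K) ℂ, g.IsHomogeneous E → mk g ∈ W := by
    intro E
    induction E using Nat.strong_induction_on with
    | _ E ih =>
      intro g hg
      by_cases hE : k ≤ E
      · obtain ⟨α, hα, β, hβ, hsum⟩ := Submodule.mem_sup.1 (hk E hE g hg)
        obtain ⟨h, rfl⟩ := (Ideal.mem_span_range_iff_exists_fun).1 hβ
        have h1 : g = homogeneousComponent E α + ∑ i, homogeneousComponent E (h i * f i) := by
          rw [← map_sum, ← map_add, hsum, homogeneousComponent_eq_self hg]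
        rw [h1, map_add, map_sum]
        refine add_mem ?_ (sum_mem fun i _ => ?_)
        · have : mk (homogeneousComponent E α) = 0 :=
            hker _ (ha.comp_mem hα E)
          rw [this]; exact zero_mem _
        · refine comp_mul_mem W.toAddSubmonoid mk.toAddMonoidHom (h i) (f i) (e i) E (hf i) ?_
          intro e' he' h' hh'
          have h2 := W.smul_mem (X i) (ih e' (by have := he i; omega) h' hh')
          rw [hsmul] at h2
          rw [mul_comm]
          simpa using h2
      · rw [g.as_sum, map_sum]
        refine sum_mem fun m hm => ?_
        have hdeg : m.degree = E := by
          exact (hg.degree_eq_sum_deg_support hm).symm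
        have h2 := W.smul_mem (C (coeff m g)) (Submodule.subset_span (s := G)
          ⟨m, by simp only [Set.mem_ofPred_eq]; omega, rfl⟩)
        rw [hsmul] at h2
        simpa [C_mul_monomial] using h2
  have htop : W = ⊤ := by
    rw [eq_top_iff]
    rintro y -
    obtain ⟨g, rfl⟩ := hmk y
    rw [← sum_homogeneousComponent g, map_sum]
    exact sum_mem fun j _ => hW j _ (homogeneousComponent_isHomogeneous j g)
  have : Module.Finite (MvPolynomial (Fin d) ℂ) B :=
    ⟨⟨hG.toFinset, by rw [hG.coe_toFinset]; exact htop⟩⟩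
  have : Algebra.IsIntegral (MvPolynomial (Fin d) ℂ) B :=
    inferInstance
  rw [← dim_poly d]
  refine Order.krullDim_le_of_strictMono
    (PrimeSpectrum.comap (algebraMap (MvPolynomial (Fin d) ℂ) B)) ?_
  intro p q hpq
  exact Ideal.IsIntegral.comap_lt_comap (R := MvPolynomial (Fin d) ℂ) hpq

lemma dim_le_of_cut {d : ℕ} {a : Ideal (MvPolynomial (Fin K) ℂ)} (ha : HomId a)
    (f : Fin d → MvPolynomial (Fin K) ℂ) (e : Fin d → ℕ) (he : ∀ k, 1 ≤ e k)
    (hf : ∀ k, (f k).IsHomogeneous (e k))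
    (hcut : ∀ x ∈ coneOf a, (∀ k, eval x (f k) = 0) → x = 0) :
    ringKrullDim (MvPolynomial (Fin K) ℂ ⧸ a) ≤ (d : ℕ) :=
  dim_le_of_cut_aux ha (Ideal.Quotient.mk a) Ideal.Quotient.mk_surjective
    (fun _ hg => Ideal.Quotient.eq_zero_iff_mem.2 hg) f e he hf hcut

lemma dim_le_succ {d : ℕ} {a : Ideal (MvPolynomial (Fin K) ℂ)} (ha : HomId a)
    (g : MvPolynomial (Fin K) ℂ) (e : ℕ) (he : 1 ≤ e) (hg : g.IsHomogeneous e)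
    (hd : ringKrullDim (MvPolynomial (Fin K) ℂ ⧸ (a ⊔ Ideal.span {g})) ≤ (d : ℕ)) :
    ringKrullDim (MvPolynomial (Fin K) ℂ ⧸ a) ≤ (d + 1 : ℕ) := by
  obtain ⟨f, hf, hcut⟩ := exists_cut d _
    (ha.sup ⟨{g}, by rintro Q rfl; exact ⟨e, hg⟩, rfl⟩) hd
  refine dim_le_of_cut ha (Fin.cons g f) (Fin.cons e (fun _ => 1)) ?_ ?_ ?_
  · intro k
    refine Fin.cases ?_ ?_ k
    · simpa using he
    · intro k; simp
  · intro k
    refine Fin.cases ?_ ?_ k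
    · simpa using hg
    · intro k; simpa using hf k
  · intro x hx hk
    refine hcut x ((mem_coneOf_sup_singleton a g x).2 ⟨hx, by simpa using hk 0⟩) ?_
    intro k
    simpa using hk k.succ

end Geometry

section Assembly

variable {K q : ℕ}

lemma interCone_insert (I : Ideal (MvPolynomial (Fin K) ℂ)) (Q : Fin q → MvPolynomial (Fin K) ℂ)
    (R : Finset (Fin q)) (i : Fin q) :
    interCone I Q (insert i R) = interCone I Q R ∩ hypCone (Q i) := by
  ext x
  simp only [interCone, Finset.mem_insert, Set.mem_inter_iff, Set.mem_iInter, forall_eq_or_imp]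
  tauto

lemma interCone_mono (I : Ideal (MvPolynomial (Fin K) ℂ)) (Q : Fin q → MvPolynomial (Fin K) ℂ)
    {R R' : Finset (Fin q)} (h : R ⊆ R') : interCone I Q R' ⊆ interCone I Q R := by
  rintro x ⟨h1, h2⟩
  refine ⟨h1, ?_⟩
  simp only [Set.mem_iInter] at h2 ⊢
  exact fun j hj => h2 j (h hj)

lemma interCone_eq (I : Ideal (MvPolynomial (Fin K) ℂ)) (hI : HomId I)
    (Q : Fin q → MvPolynomial (Fin K) ℂ) (d : Fin q → ℕ) (hQ : ∀ j, (Q j).IsHomogeneous (d j))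
    (R : Finset (Fin q)) :
    ∃ a, HomId a ∧ interCone I Q R = coneOf a := by
  induction R using Finset.induction_on with
  | empty => exact ⟨I, hI, by simp [interCone]⟩
  | insert i R _ ih =>
    obtain ⟨a, ha, hR⟩ := ih
    refine ⟨a ⊔ Ideal.span {Q i}, ha.sup ⟨{Q i}, by rintro _ rfl; exact ⟨_, hQ i⟩, rfl⟩, ?_⟩
    rw [interCone_insert, hR]
    ext x
    rw [mem_coneOf_sup_singleton]
    rfl

lemma coneDim_insert (I : Ideal (MvPolynomial (Fin K) ℂ)) (hI : HomId I)
    (Q : Fin q → MvPolynomial (Fin K) ℂ) (d : Fin q → ℕ) (hd : ∀ j, 1 ≤ d j)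
    (hQ : ∀ j, (Q j).IsHomogeneous (d j)) (R : Finset (Fin q)) (i : Fin q) :
    coneDim (interCone I Q R) ≤ coneDim (interCone I Q (insert i R)) + 1 := by
  obtain ⟨a, ha, hR⟩ := interCone_eq I hI Q d hQ R
  have h2 : interCone I Q (insert i R) = coneOf (a ⊔ Ideal.span {Q i}) := by
    rw [interCone_insert, hR]
    ext x
    rw [mem_coneOf_sup_singleton]
    rfl
  rw [hR, h2, coneDim_coneOf_le_iff]
  exact dim_le_succ ha (Q i) (d i) (hd i) (hQ i) ((coneDim_coneOf_le_iff _ _).1 le_rfl)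

end Assembly

/-- **Proposition 2.5.** Existence of Nochka weights `ω(1), …, ω(q)` and a Nochka
constant `Θ` for hypersurfaces in `N`-subgeneral position: (i) `0 < ω(j) ≤ Θ ≤ 1`;
(ii) `∑ ω(j) = Θ(q-2N+n-1) + n + 1`; (iii) `(n+1)/(2N-n+1) ≤ Θ ≤ (n+1)/(N+1)`;
(iv) `∑_{j∈R} ω(j) ≤ c(R)` whenever `0 < #R ≤ N+1`. -/
theorem statement12 {M n N q : ℕ} (hn : 1 ≤ n) (hNn : n ≤ N) (hq : 2 * N - n + 1 ≤ q)
    (I : Ideal (MvPolynomial (Fin (M + 1)) ℂ)) (hV : IsSmoothVariety n I)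
    (Q : Fin q → MvPolynomial (Fin (M + 1)) ℂ) (d : Fin q → ℕ)
    (hd : ∀ j, 1 ≤ d j) (hQ : ∀ j, (Q j).IsHomogeneous (d j))
    (hsub : InSubgenPos n N I Q) :
    ∃ (ω : Fin q → ℝ) (Θ : ℝ),
      (∀ j, 0 < ω j ∧ ω j ≤ Θ) ∧ Θ ≤ 1 ∧
      (∑ j, ω j) = Θ * ((q : ℝ) - 2 * N + n - 1) + n + 1 ∧
      ((n : ℝ) + 1) / (2 * (N : ℝ) - (n : ℝ) + 1) ≤ Θ ∧
      Θ ≤ ((n : ℝ) + 1) / ((N : ℝ) + 1) ∧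
      ∀ R : Finset (Fin q), 0 < R.card → R.card ≤ N + 1 →
        (∑ j ∈ R, ω j) ≤ (cdim n I Q R : ℝ) := by
  obtain ⟨⟨⟨hprime, hIhom, hdim⟩, -⟩, hnot, hSI, hSII⟩ := And.intro hV hsub
  have hI : HomId I := hIhom
  have h00 : interCone I Q ∅ = coneOf I := by simp [interCone]
  have htop : coneDim (interCone I Q ∅) = n + 1 := by
    rw [h00]
    apply le_antisymm
    · rw [coneDim_coneOf_le_iff, hdim]; exact le_rfl
    · have h := (coneDim_coneOf_le_iff I _).1 le_rfl
      rw [hdim] at h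
      exact_mod_cast h
  have hle : ∀ R, coneDim (interCone I Q R) ≤ n + 1 := fun R => by
    rw [← htop]; exact coneDim_mono (interCone_mono I Q (Finset.empty_subset R))
  have hcd : ∀ R, cdim n I Q R + coneDim (interCone I Q R) = n + 1 := fun R => by
    have := hle R
    unfold cdim; omega
  have hmono : ∀ A B, A ⊆ B → cdim n I Q A ≤ cdim n I Q B := by
    intro A B hAB
    have h1 := coneDim_mono (interCone_mono I Q hAB)
    have := hcd A
    have := hcd B
    omega
  have hunit : ∀ A i, cdim n I Q (insert i A) ≤ cdim n I Q A + 1 := by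
    intro A i
    have h1 := coneDim_insert I hI Q d hd hQ A i
    have := hcd A
    have := hcd (insert i A)
    omega
  have h0 : cdim n I Q ∅ = 0 := by
    have := hcd ∅
    omega
  have h1 : ∀ i, 1 ≤ cdim n I Q {i} := by
    intro i
    have hi : Q i ∉ I := fun hmem => hnot i (fun x hx => hx _ hmem)
    have h2 : interCone I Q {i} = coneOf (I ⊔ Ideal.span {Q i}) := by
      ext x
      rw [mem_coneOf_sup_singleton]
      simp [interCone, hypCone]
    have h3 : coneDim (interCone I Q {i}) ≤ n := by
      rw [h2, coneDim_coneOf_le_iff]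
      refine dim_cut_le hdim.le (Q i) ?_
      intro p hp
      right
      have : p = I := by
        have := hprime
        rw [Ideal.minimalPrimes_eq_subsingleton_self] at hp
        exact hp
      rwa [this]
    have := hcd {i}
    omega
  have hfull : ∀ R : Finset (Fin q), R.card = N + 1 → cdim n I Q R = n + 1 := by
    intro R hR
    have h2 := coneDim_of_subset_zero (hSI R hR)
    have := hcd R
    omega
  have hclos : ∀ J T, cdim n I Q J = J.card → (∀ i ∈ T, cdim n I Q (insert i J) = cdim n I Q J) →
      cdim n I Q (J ∪ T) = cdim n I Q J := by
    intro J T hJ hT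
    have hm := hmono J (J ∪ T) Finset.subset_union_left
    have e1 := hcd J
    have e2 := hcd (J ∪ T)
    by_cases hJ0 : J.card = 0
    · have hJe : J = ∅ := Finset.card_eq_zero.1 hJ0
      subst hJe
      have hTe : T = ∅ := by
        rw [Finset.eq_empty_iff_forall_notMem]
        intro i hi
        have h2 := hT i hi
        have h3 := h1 i
        simp only [insert_empty_eq] at h2
        omega
      subst hTe
      simp
    by_cases hx : ∃ x ∈ interCone I Q J, x ≠ 0
    · have hgp : GenPos n I Q J := by
        intro J' hJ' _ hJ'n
        have hind := NochkaAux.indep_subset _ h0 hunit J' J hJ' hJ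
        have e3 := hcd J'
        obtain ⟨a, ha, hR⟩ := interCone_eq I hI Q d hQ J'
        obtain ⟨f, hf, hcut⟩ := exists_cut (n + 1 - J'.card) a ha (by
          rw [← coneDim_coneOf_le_iff, ← hR]; omega)
        refine ⟨f, fun k => ⟨1, le_rfl, hf k⟩, ?_⟩
        rw [hR]
        exact hcut
      obtain ⟨σ, hσ, hσd, hσi⟩ := hSII J (by omega) (by omega) hgp hx
      have hsubset : σ ⊆ interCone I Q (J ∪ T) := by
        intro x hxσ
        have hxJ := hσ.1 hxσ
        refine ⟨hxJ.1, ?_⟩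
        have hxJ2 := hxJ.2
        simp only [Set.mem_iInter, Finset.mem_union] at hxJ2 ⊢
        intro i hi
        by_cases hiJ : i ∈ J
        · exact hxJ2 i hiJ
        · have hiT : i ∈ T := hi.resolve_left hiJ
          refine hσi i hiJ ?_ hxσ
          have := hT i hiT
          have := hcd (insert i J)
          omega
      have h3 := coneDim_mono hsubset
      omega
    · push Not at hx
      have h2 := coneDim_of_subset_zero hx
      omega
  exact NochkaAux.nochka hNn hq (cdim n I Q) h0 h1 (fun R => by have := hcd R; omega) hmono hunit
    hclos hfull

end SMT
end
end

section
/- Let V ⊂ ℂP^M be a smooth complex projective variety of dimension n ≥ 1, let Q_1,…,Q_q be homogeneous polynomials of the same degree d with V ∩ {Q_1 = ⋯ = Q_q = 0} = ∅, and let Y ⊂ ℂP^{q−1} be the image of V under Φ = (Q_1 : ⋯ : Q_q). Let f: ℂ → V be an algebraically nondegenerate holomorphic map with reduced representation (f_0 : ⋯ : f_M). Fix an integer m ≥ 1 and let I_1,…,I_{q_m} (q_m = C(q+m−1, m)) be all q-tuples I_i = (I_{i1},…,I_{iq}) of nonnegative integers with I_{i1}+⋯+I_{iq} = m. Then the complex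 vector space spanned by the entire functions Q_1^{I_{i1}}(f)⋯Q_q^{I_{iq}}(f), i = 1,…,q_m, has dimension exactly H_Y(m), the Hilbert function of Y at m. -/
open MvPolynomial Filter

noncomputable section

namespace SMT

/-- For an algebraically nondegenerate holomorphic `f : ℂ → V` and homogeneous `Q_j` of
common degree `d` with no common zero on `V`, the vector space spanned by the entire
functions `Q_1^{I_{i1}}(f) ⋯ Q_q^{I_{iq}}(f)` over all exponent tuples with
`I_{i1} + ⋯ + I_{iq} = m` has dimension exactly `H_Y(m)`, the Hilbert function of the
image variety `Y = Φ(V) ⊂ ℂP^{q-1}`. -/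
theorem statement17 {M n q m : ℕ} (hn : 1 ≤ n) (hm : 1 ≤ m)
    (I : Ideal (MvPolynomial (Fin (M + 1)) ℂ)) (hV : IsSmoothVariety n I)
    (d : ℕ) (hd : 1 ≤ d)
    (Q : Fin q → MvPolynomial (Fin (M + 1)) ℂ) (hQ : ∀ j, (Q j).IsHomogeneous d)
    (hzero : ∀ x ∈ coneOf I, (∀ j, MvPolynomial.eval x (Q j) = 0) → x = 0)
    (f : Fin (M + 1) → ℂ → ℂ) (hf : ReducedRepr f) (hfV : AlgNondeg f I) :
    Module.finrank ℂ (Submodule.span ℂ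
      {g : ℂ → ℂ | ∃ a : Fin q → ℕ, (∑ j, a j) = m ∧
        g = fun z => ∏ j, polyComp (Q j) f z ^ a j}) =
      hilbert (vIdeal (imgCone I Q)) m := by
  classical
  let L : MvPolynomial (Fin q) ℂ →ₗ[ℂ] (ℂ → ℂ) :=
    { toFun := fun P z => MvPolynomial.eval (fun j => polyComp (Q j) f z) P
      map_add' := by
        intro a b
        funext z
        simp
      map_smul' := by
        intro c a
        funext z
        simp [MvPolynomial.smul_eval] }
  have hL : ∀ P z, L P z = MvPolynomial.eval (fun j => polyComp (Q j) f z) P := fun _ _ => rfl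
  let W := MvPolynomial.homogeneousSubmodule (Fin q) ℂ m
  let T : W →ₗ[ℂ] (ℂ → ℂ) := L.comp W.subtype
  have hker : LinearMap.ker T = Submodule.comap W.subtype
      (Submodule.restrictScalars ℂ (vIdeal (imgCone I Q))) := by
    ext P
    have hP : (P : MvPolynomial (Fin q) ℂ).IsHomogeneous m := P.2
    have hev : ∀ x : Fin (M + 1) → ℂ, MvPolynomial.eval x (MvPolynomial.bind₁ Q P.1) =
        MvPolynomial.eval (fun j => MvPolynomial.eval x (Q j)) P.1 := by
      intro x
      have h := MvPolynomial.aeval_bind₁ (S := ℂ) x Q P.1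
      simpa only [MvPolynomial.aeval_eq_eval, MvPolynomial.coe_aeval_eq_eval] using h
    have hhom : (MvPolynomial.bind₁ Q P.1).IsHomogeneous (d * m) :=
      hP.aeval Q hQ
    constructor
    · intro h
      have h0 : L P.1 = 0 := h
      have hI : MvPolynomial.bind₁ Q P.1 ∈ I := by
        by_contra hc
        obtain ⟨z, hz⟩ := hfV.2 _ ⟨_, hhom⟩ hc
        apply hz
        have := congrFun h0 z
        rw [hL] at this
        unfold polyComp at this ⊢
        rw [hev]
        exact this
      change P.1 ∈ vIdeal (imgCone I Q)
      rintro y ⟨x, hx, rfl⟩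
      have := hx _ hI
      rw [hev] at this
      exact this
    · intro h
      have h1 : P.1 ∈ vIdeal (imgCone I Q) := h
      change L P.1 = 0
      funext z
      exact h1 _ ⟨_, hfV.1 z, rfl⟩
  have hrange : Submodule.span ℂ {g : ℂ → ℂ | ∃ a : Fin q → ℕ, (∑ j, a j) = m ∧
        g = fun z => ∏ j, polyComp (Q j) f z ^ a j} = LinearMap.range T := by
    apply le_antisymm
    · rw [Submodule.span_le]
      rintro g ⟨a, ha, rfl⟩
      refine ⟨⟨MvPolynomial.monomial (Finsupp.equivFunOnFinite.symm a) 1, ?_⟩, ?_⟩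
      · apply MvPolynomial.isHomogeneous_monomial
        rw [Finsupp.degree_eq_sum]
        simpa using ha
      · funext z
        change L (MvPolynomial.monomial (Finsupp.equivFunOnFinite.symm a) 1) z = _
        rw [hL, MvPolynomial.eval_monomial, Finsupp.prod_fintype _ _ (by simp)]
        simp
    · rintro g ⟨P, rfl⟩
      have hP : (P : MvPolynomial (Fin q) ℂ).IsHomogeneous m := P.2
      change L P.1 ∈ _
      rw [MvPolynomial.as_sum P.1, map_sum]
      refine Submodule.sum_mem _ fun s hs => ?_
      have : L (MvPolynomial.monomial s (MvPolynomial.coeff s P.1)) =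
          MvPolynomial.coeff s P.1 • (fun z => ∏ j, polyComp (Q j) f z ^ s j) := by
        funext z
        rw [hL, MvPolynomial.eval_monomial, Finsupp.prod_fintype _ _ (by simp)]
        simp
      rw [this]
      refine Submodule.smul_mem _ _ (Submodule.subset_span ⟨s, ?_, rfl⟩)
      rw [← Finsupp.degree_eq_sum, Finsupp.degree_eq_weight_one]
      exact hP (MvPolynomial.mem_support_iff.mp hs)
  rw [hrange]
  unfold hilbert
  rw [← hker]
  exact (LinearMap.quotKerEquivRange T).finrank_eq.symm

end SMT
end
end
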